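/- Let X be a compact metric space, and let (μ_k) and μ be Borel probability measures on X such that μ_k converges to μ in the weak* topology (i.e., ∫ g dμ_k → ∫ g dμ for every continuous g : X → ℝ). Then sup_{z ∈ supp μ} dist(z, supp μ_k) → 0 as k → ∞; equivalently, for every ε > 0 there exists K such that for all k ≥ K, the support of μ is contained in the open ε-neighborhood of the support of μ_k. -/

import Mathlib

open MeasureTheory Filter Topology Metric

/-- The topological support of a Borel measure: the set of points all of whose
open neighborhoods have positive measure.  In a (second countable, e.g. compact)
metric space this is the smallest closed set of full measure. -/
def measSupport {X : Type*} [TopologicalSpace X] [MeasurableSpace X]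
    (μ : Measure X) : Set X :=
  {x | ∀ U : Set X, IsOpen U → x ∈ U → 0 < μ U}

/-- If Borel probability measures `μ_k` on a compact metric space converge to `μ`
in the weak* topology, then `sup_{z ∈ supp μ} dist(z, supp μ_k) → 0`; equivalently,
for every `ε > 0` the support of `μ` is eventually contained in the open
`ε`-neighborhood of the support of `μ_k`. -/
theorem supp_limit_subset_thickening_of_weakStar
    {X : Type*} [MetricSpace X] [CompactSpace X] [MeasurableSpace X] [BorelSpace X]
    (μs : ℕ → Measure X) (μ : Measure X)
    [∀ k, IsProbabilityMeasure (μs k)] [IsProbabilityMeasure μ]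
    (hconv : ∀ g : C(X, ℝ),
      Tendsto (fun k => ∫ x, g x ∂(μs k)) atTop (𝓝 (∫ x, g x ∂μ))) :
    ∀ ε > 0, ∃ K : ℕ, ∀ k ≥ K,
      measSupport μ ⊆ Metric.thickening ε (measSupport (μs k)) := by
  intro ε hε
  have key : ∀ (ν : Measure X), measSupport ν = ν.support := by
    intro ν
    ext x
    rw [Measure.mem_support_iff_forall]
    constructor
    · intro h U hU
      obtain ⟨V, hVU, hV, hx⟩ := _root_.mem_nhds_iff.1 hU
      exact (h V hV hx).trans_le (measure_mono hVU)
    · intro h U hU hx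
      exact h U (hU.mem_nhds hx)
  let P : ProbabilityMeasure X := ⟨μ, inferInstance⟩
  let Ps : ℕ → ProbabilityMeasure X := fun k => ⟨μs k, inferInstance⟩
  have hP : Tendsto Ps atTop (𝓝 P) := by
    rw [ProbabilityMeasure.tendsto_iff_forall_integral_tendsto]
    intro f
    exact hconv f.toContinuousMap
  have htb : TotallyBounded (measSupport μ) :=
    isCompact_univ.totallyBounded.subset (Set.subset_univ _)
  obtain ⟨t, htS, htf, hcov⟩ := Metric.finite_approx_of_totallyBounded htb (ε / 2) (half_pos hε)
  have hev : ∀ᶠ k in atTop, ∀ y ∈ t, 0 < μs k (ball y (ε / 2)) := by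
    rw [htf.eventually_all]
    intro y hy
    have h1 : 0 < μ (ball y (ε / 2)) := htS hy _ isOpen_ball (mem_ball_self (half_pos hε))
    exact eventually_lt_of_lt_liminf
      (h1.trans_le (ProbabilityMeasure.le_liminf_measure_open_of_tendsto hP isOpen_ball))
  obtain ⟨K, hK⟩ := eventually_atTop.1 hev
  refine ⟨K, fun k hk z hz => ?_⟩
  obtain ⟨y, hy, hzy⟩ := Set.mem_iUnion₂.1 (hcov hz)
  obtain ⟨w, hw, hws⟩ := Measure.nonempty_inter_support_of_pos (hK k hk y hy)
  rw [mem_thickening_iff, key]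
  refine ⟨w, hws, ?_⟩
  rw [mem_ball] at hw hzy
  linarith [dist_triangle_right z w y]
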